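/- Let m be a positive integer divisible by 32, let L and R be finite sets with |L| = |R| = m/2, let M ⊆ L with |M| = m/4, and let R_1, …, R_{m/4} be a fixed partition of R into two-element sets. Suppose (S_i)_{i∈L} are independent random variables, each distributed uniformly on the (m/4)-element subsets of R (equivalently, a function S : L → {(m/4)-subsets of R} is chosen uniformly at random). Then the probability that for every i ∈ M at most m/16 of the blocks R_j satisfy |S_i ∩ R_j| = 1 is at most 2^{m/4} · exp(−m²/512). -/

import Mathlib

open Finset

lemma aux_central (n : ℕ) (hn : 1 ≤ n) : 16 ^ n ≤ 4 * n * n.centralBinom ^ 2 := by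
  induction n, hn using Nat.le_induction with
  | base => simp [Nat.centralBinom, Nat.choose]
  | succ n hn ih =>
    have h := Nat.succ_mul_centralBinom_succ n
    have h1 : 0 < n + 1 := by omega
    refine Nat.le_of_mul_le_mul_left ?_ h1
    have e : (n + 1) * (4 * (n + 1) * (n + 1).centralBinom ^ 2)
        = 4 * ((n + 1) * (n + 1).centralBinom) ^ 2 := by ring
    rw [e, h]
    calc (n + 1) * 16 ^ (n + 1) = 16 * (n + 1) * 16 ^ n := by ring
      _ ≤ 16 * (n + 1) * (4 * n * n.centralBinom ^ 2) := Nat.mul_le_mul_left _ ih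
      _ = (4 * n * (n + 1)) * (16 * n.centralBinom ^ 2) := by ring
      _ ≤ ((2 * n + 1) ^ 2) * (16 * n.centralBinom ^ 2) :=
          Nat.mul_le_mul_right _ (by nlinarith)
      _ = _ := by ring

lemma aux_count {R : Type*} [Fintype R] [DecidableEq R] (k n : ℕ) (hn : n = 8 * k)
    (B : Fin n → Finset R) (hB2 : ∀ j, (B j).card = 2) (hBcover : ∀ r : R, ∃ j, r ∈ B j)
    (A : Finset (Finset R))
    (hA : ∀ S ∈ A, (Finset.univ.filter (fun j => (S ∩ B j).card = 1)).card ≤ 2 * k) :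
    A.card * 3 ^ (6 * k) ≤ 8 ^ (8 * k) := by
  classical
  let w : ℕ → ℕ := fun c => if c = 1 then 1 else 3
  have h8 : ∀ j, ∑ T ∈ (B j).powerset, w T.card = 8 := by
    intro j
    rw [Finset.sum_powerset_apply_card w, hB2 j]
    simp [Finset.sum_range_succ, w]
  have hprod : ∏ j, ∑ T ∈ (B j).powerset, w T.card = 8 ^ (8 * k) := by
    simp [h8, hn]
  rw [← hprod, Finset.prod_univ_sum]
  let F : Finset R → (Fin n → Finset R) := fun S j => S ∩ B j
  have hinj : Function.Injective F := by
    intro S T h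
    ext r
    obtain ⟨j, hj⟩ := hBcover r
    have := congrArg (fun G => r ∈ G j) h
    simpa [F, hj] using this
  calc A.card * 3 ^ (6 * k) = ∑ S ∈ A, 3 ^ (6 * k) := by simp
    _ ≤ ∑ S ∈ A, ∏ j, w (F S j).card := by
        refine Finset.sum_le_sum fun S hS => ?_
        have h1 := hA S hS
        have h2 := Finset.card_filter_add_card_filter_not (s := (Finset.univ : Finset (Fin n)))
          (fun j => (S ∩ B j).card = 1)
        simp only [Finset.card_univ, Fintype.card_fin] at h2
        simp only [w, F]
        rw [Finset.prod_ite]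
        simp only [Finset.prod_const, one_pow, one_mul]
        exact Nat.pow_le_pow_right (by norm_num) (by omega)
    _ = ∑ G ∈ A.image F, ∏ j, w (G j).card := by
        rw [Finset.sum_image (fun _ _ _ _ h => hinj h)]
    _ ≤ _ := by
        refine Finset.sum_le_sum_of_subset ?_
        intro G hG
        obtain ⟨S, -, rfl⟩ := Finset.mem_image.1 hG
        simp [Fintype.mem_piFinset, F]

lemma le_of_sq_le_sq_aux {x y : ℝ} (h : x ^ 2 ≤ y ^ 2) (hy : 0 ≤ y) : x ≤ y :=
  abs_le_of_sq_le_sq' h hy |>.2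

lemma aux_num (k a : ℕ) (hk : 2 ≤ k) (ha : a * 3 ^ (6 * k) ≤ 8 ^ (8 * k)) :
    (a : ℝ) ≤ 2 * Real.exp (-(k : ℝ) / 4) * ((8 * k).centralBinom : ℝ) := by
  have hc := aux_central (8 * k) (by omega)
  have hkk : 8 * k ≤ 4 ^ k := by
    clear ha hc
    induction k, hk using Nat.le_induction with
    | base => norm_num
    | succ n hn ih => rw [pow_succ]; omega
  set C := (8 * k).centralBinom
  have hcR : (16 : ℝ) ^ (8 * k) ≤ 4 * (8 * k) * (C : ℝ) ^ 2 := by exact_mod_cast hc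
  have hkR : (8 : ℝ) * k ≤ 4 ^ k := by exact_mod_cast hkk
  have haR : (a : ℝ) * 3 ^ (6 * k) ≤ 8 ^ (8 * k) := by exact_mod_cast ha
  have he : Real.exp (k / 2 : ℝ) ≤ 2 ^ k := by
    have h1 : Real.exp (1 / 2) ≤ 2 := by
      have h2 : Real.exp (1 / 2) ^ 2 = Real.exp 1 := by
        rw [← Real.exp_nat_mul]; norm_num
      have := Real.exp_one_lt_d9
      nlinarith [Real.exp_pos (1 / 2)]
    have h3 : Real.exp (k / 2 : ℝ) = Real.exp (1 / 2) ^ k := by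
      rw [← Real.exp_nat_mul]; congr 1; ring
    rw [h3]
    exact pow_le_pow_left₀ (Real.exp_pos _).le h1 k
  have hE : Real.exp (-(k : ℝ) / 4) ^ 2 * Real.exp (k / 2 : ℝ) = 1 := by
    rw [← Real.exp_nat_mul, ← Real.exp_add]
    rw [Real.exp_eq_one_iff]; push_cast; ring
  have key : (a : ℝ) ^ 2 * Real.exp (k / 2 : ℝ) ≤ 4 * (C : ℝ) ^ 2 := by
    have hp : (0 : ℝ) < 3 ^ (12 * k) := by positivity
    refine le_of_mul_le_mul_right ?_ hp
    have s1 : ((a : ℝ) * 3 ^ (6 * k)) ^ 2 ≤ (8 ^ (8 * k)) ^ 2 :=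
      pow_le_pow_left₀ (by positivity) haR 2
    calc (a : ℝ) ^ 2 * Real.exp (k / 2 : ℝ) * 3 ^ (12 * k)
        = ((a : ℝ) * 3 ^ (6 * k)) ^ 2 * Real.exp (k / 2 : ℝ) := by
          rw [mul_pow, ← pow_mul, show 6 * k * 2 = 12 * k by ring]; ring
      _ ≤ (8 ^ (8 * k)) ^ 2 * 2 ^ k := by gcongr
      _ = 16 ^ (8 * k) * (4 ^ 8 * 2) ^ k := by
          rw [← pow_mul, show 8 * k * 2 = 16 * k by ring]
          simp only [pow_mul, ← mul_pow]; norm_num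
      _ ≤ (4 * (8 * k) * (C : ℝ) ^ 2) * (4 ^ 8 * 2) ^ k := by gcongr
      _ ≤ (4 * 4 ^ k * (C : ℝ) ^ 2) * (4 ^ 8 * 2) ^ k := by gcongr
      _ = 4 * (C : ℝ) ^ 2 * (4 ^ 9 * 2) ^ k := by
          rw [show (4 : ℝ) ^ 9 * 2 = 4 * (4 ^ 8 * 2) by norm_num, mul_pow 4 (4 ^ 8 * 2 : ℝ)]; ring
      _ ≤ 4 * (C : ℝ) ^ 2 * 3 ^ (12 * k) := by
          rw [pow_mul 3 12 k]
          gcongr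
          norm_num
  refine le_of_sq_le_sq_aux ?_ (by positivity)
  calc (a : ℝ) ^ 2 = Real.exp (-(k : ℝ) / 4) ^ 2 * ((a : ℝ) ^ 2 * Real.exp (k / 2 : ℝ)) := by
        linear_combination (-(a : ℝ) ^ 2) * hE
    _ ≤ Real.exp (-(k : ℝ) / 4) ^ 2 * (4 * (C : ℝ) ^ 2) := by gcongr
    _ = _ := by ring

/-- The bound `Pr[E(M, P)] ≤ 2^{m/4}·exp(−m²/512)` from the proof of Lemma 4 of the
paper: with `(S i)_{i ∈ L}` chosen as a uniformly random function from `L` to the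
`(m/4)`-element subsets of `R` (i.e., independently uniform `(m/4)`-subsets), the
probability that the fixed pair-partition `B` is a segmentation of every agent in a
fixed set `M ⊆ L` of size `m/4` — i.e., that for every `i ∈ M` at most `m/16` blocks
meet `S i` in exactly one element — is at most `2^{m/4}·exp(−m²/512)`. The probability
is expressed as the number of such functions divided by the total number
`C(m/2, m/4)^{m/2}` of functions. -/
theorem fixed_M_partition_segmentation_probability_bound
    {L R : Type*} [Fintype L] [Fintype R] [DecidableEq L] [DecidableEq R]
    (m : ℕ) (hm : 0 < m) (h32 : 32 ∣ m)
    (hL : Fintype.card L = m / 2) (hR : Fintype.card R = m / 2)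
    (M : Finset L) (hM : M.card = m / 4)
    (B : Fin (m / 4) → Finset R)
    (hB2 : ∀ j, (B j).card = 2)
    (hBdisj : ∀ j k, j ≠ k → Disjoint (B j) (B k))
    (hBcover : ∀ r : R, ∃ j, r ∈ B j) :
    (Nat.card {S : L → Finset R //
        (∀ i, (S i).card = m / 4) ∧
        ∀ i ∈ M, (Finset.univ.filter (fun j => (S i ∩ B j).card = 1)).card ≤ m / 16} : ℝ)
      / (Nat.choose (m / 2) (m / 4) : ℝ) ^ (m / 2)
    ≤ 2 ^ (m / 4) * Real.exp (-(m : ℝ) ^ 2 / 512) := by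
  classical
  obtain ⟨k, rfl⟩ := h32
  have hk : 1 ≤ k := by omega
  have e4 : 32 * k / 4 = 8 * k := by omega
  have e2 : 32 * k / 2 = 16 * k := by omega
  have e16 : 32 * k / 16 = 2 * k := by omega
  rw [e2] at hL hR
  rw [e4] at hM
  set All : Finset (Finset R) := Finset.powersetCard (32 * k / 4) Finset.univ with hAll
  set Bad : Finset (Finset R) := All.filter
    (fun S => (Finset.univ.filter (fun j => (S ∩ B j).card = 1)).card ≤ 32 * k / 16) with hBad
  have hAllc : All.card = (8 * k).centralBinom := by
    rw [hAll, Finset.card_powersetCard, Finset.card_univ, hR, e4, Nat.centralBinom]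
    congr 1; ring
  have hcount : Nat.card {S : L → Finset R //
        (∀ i, (S i).card = 32 * k / 4) ∧
        ∀ i ∈ M, (Finset.univ.filter (fun j => (S i ∩ B j).card = 1)).card ≤ 32 * k / 16}
      = Bad.card ^ (8 * k) * All.card ^ (8 * k) := by
    rw [Nat.subtype_card (Fintype.piFinset (fun i => if i ∈ M then Bad else All))]
    · rw [Fintype.card_piFinset]
      have : ∀ i, (if i ∈ M then Bad else All).card = if i ∈ M then Bad.card else All.card := by
        intro i; split_ifs <;> rfl
      simp only [this]
      rw [Finset.prod_ite]
      have h2 := Finset.card_filter_add_card_filter_not (s := (Finset.univ : Finset L))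
          (fun i => i ∈ M)
      have h3 : (Finset.univ.filter (fun i => i ∈ M)).card = 8 * k := by
        rw [← hM]; congr 1; ext; simp
      rw [Finset.card_univ, hL, h3] at h2
      have h4 : (Finset.univ.filter (fun i => ¬ i ∈ M)).card = 8 * k := by omega
      rw [Finset.prod_const, Finset.prod_const, h3, h4]
    · intro S
      rw [Fintype.mem_piFinset]
      constructor
      · intro h
        refine ⟨fun i => ?_, fun i hi => ?_⟩
        · have := h i
          split_ifs at this <;> simp_all [Finset.mem_powersetCard]
        · have := h i
          rw [if_pos hi, hBad, Finset.mem_filter] at this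
          exact this.2
      · rintro ⟨h1, h2⟩ i
        have hm1 : S i ∈ All := by rw [hAll, Finset.mem_powersetCard]; exact ⟨Finset.subset_univ _, h1 i⟩
        split_ifs with hi
        · rw [hBad, Finset.mem_filter]; exact ⟨hm1, h2 i hi⟩
        · exact hm1
  have hbad : (Bad.card : ℝ) ≤ 2 * Real.exp (-(k : ℝ) / 4) * ((8 * k).centralBinom : ℝ) := by
    rcases Nat.lt_or_ge k 2 with h | h
    · have hk1 : k = 1 := by omega
      have h1 : (Bad.card : ℝ) ≤ ((8 * k).centralBinom : ℝ) := by
        rw [← hAllc]; exact_mod_cast Finset.card_filter_le _ _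
      have h2 : (1 : ℝ) ≤ 2 * Real.exp (-(k : ℝ) / 4) := by
        have := Real.add_one_le_exp (-(k : ℝ) / 4)
        rw [hk1] at this ⊢
        norm_num at this ⊢
        linarith
      have h3 : (0 : ℝ) ≤ ((8 * k).centralBinom : ℝ) := by positivity
      nlinarith
    · refine aux_num k _ h (aux_count k _ e4 B hB2 hBcover Bad ?_)
      intro S hS
      rw [hBad, Finset.mem_filter, e16] at hS
      exact hS.2
  have hCpos : (0 : ℝ) < ((8 * k).centralBinom : ℝ) := by exact_mod_cast Nat.centralBinom_pos _
  have hch : Nat.choose (32 * k / 2) (32 * k / 4) = (8 * k).centralBinom := by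
    rw [e2, e4, Nat.centralBinom]; congr 1; ring
  rw [hcount, hAllc, hch, e4, e2]
  push_cast
  rw [div_le_iff₀ (by positivity)]
  have hpow := pow_le_pow_left₀ (by positivity) hbad (8 * k)
  have hexp : Real.exp (-(32 * (k : ℝ)) ^ 2 / 512) = Real.exp (-(k : ℝ) / 4) ^ (8 * k) := by
    rw [← Real.exp_nat_mul]; congr 1; push_cast; ring
  rw [hexp]
  calc (Bad.card : ℝ) ^ (8 * k) * ((8 * k).centralBinom : ℝ) ^ (8 * k)
      ≤ (2 * Real.exp (-(k : ℝ) / 4) * ((8 * k).centralBinom : ℝ)) ^ (8 * k)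
        * ((8 * k).centralBinom : ℝ) ^ (8 * k) := by gcongr
    _ = _ := by
      rw [mul_pow, mul_pow, show 16 * k = 8 * k + 8 * k by ring, pow_add]; ring
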